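/- Let R be a commutative ring, x, y, t ∈ R, and n a positive integer. For every positive integer k, the n×n determinant det_{0≤i,j≤n−1}(P_j(i,k) + t·(xy)^i·P_j(−i,k)) equals (−1)^{kn₁+C(k,2)}·(1+t)·t^{k(n₁−1)}·(xy)^{k(n₁−1)(2kn₁−k+1)} if n = 2kn₁−k+1 for a positive integer n₁; it equals (−1)^{kn₁}·(1+t)·t^{kn₁−1}·(xy)^{kn₁(2kn₁−k−1)} if n = 2kn₁ for a positive integer n₁; and it equals 0 if n is congruent to neither 0 nor k+1 modulo 2k. For k = 0, det_{0≤i,j≤n−1}(P_j(i,0) + t·(xy)^i·P_j(−i,0)) = (1+t)^n·(xy)^{C(n,2)}. -/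

import Mathlib

/-- `pgf x y n k` is the generating function `P_n(0,k)` of lattice paths from `(0,0)` to
`(n,k)` with steps `(1,1)`, `(1,0)`, `(1,-1)`, weighted `1`, `x+y`, `xy` respectively:
`P_n(0,k) = Σ_ℓ C(n,ℓ)·C(n,n−k−ℓ)·x^ℓ·y^{n−k−ℓ}`, the sum over integers `ℓ ≥ 0` with
`n−k−ℓ ≥ 0` (terms with `ℓ > n` vanish since then `C(n,ℓ) = 0`).
`P_n(l,k)` is then `pgf x y n (k - l)`. -/
def pgf {R : Type*} [CommRing R] (x y : R) (n : ℕ) (k : ℤ) : R :=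
  ∑ ℓ ∈ Finset.range (n + 1),
    if (ℓ : ℤ) ≤ (n : ℤ) - k then
      (n.choose ℓ : R) * (n.choose ((n : ℤ) - k - ℓ).toNat : R) *
        x ^ ℓ * y ^ ((n : ℤ) - k - ℓ).toNat
    else 0

/-- The matrix of Theorem 10, with `(i,j)`-entry
`P_j(i,k) + t·(xy)^i·P_j(−i,k) = pgf x y j (k−i) + t·(xy)^i·pgf x y j (k+i)`. -/
def thm10Matrix {R : Type*} [CommRing R] (x y t : R) (n : ℕ) (k : ℤ) :
    Matrix (Fin n) (Fin n) R :=
  Matrix.of fun i j =>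
    pgf x y j.1 (k - i.1) + t * (x * y) ^ (i.1 : ℕ) * pgf x y j.1 (k + i.1)

section PathGeneratingFunction

variable {R : Type*} [CommRing R] (x y : R)

theorem pgf_eq_zero_of_lt {n : ℕ} {k : ℤ} (h : (n : ℤ) < k) : pgf x y n k = 0 := by
  unfold pgf
  refine Finset.sum_eq_zero fun ℓ _ => if_neg ?_
  omega

theorem pgf_natCast {n m : ℕ} (h : m ≤ n) :
    pgf x y n (m : ℤ) = ∑ ℓ ∈ Finset.range (n - m + 1),
      (n.choose ℓ : R) * (n.choose (n - m - ℓ) : R) * x ^ ℓ * y ^ (n - m - ℓ) := by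
  unfold pgf
  rw [show n + 1 = (n - m + 1) + m by omega, Finset.sum_range_add,
    Finset.sum_eq_zero (s := Finset.range m), add_zero]
  · refine Finset.sum_congr rfl fun ℓ hℓ => ?_
    rw [Finset.mem_range] at hℓ
    rw [if_pos (by omega), show ((n : ℤ) - m - ℓ).toNat = n - m - ℓ by omega]
  · intro ℓ _
    exact if_neg (by omega)

theorem pgf_self (n : ℕ) : pgf x y n (n : ℤ) = 1 := by
  simp [pgf_natCast x y le_rfl]

/-- Reflecting a path multiplies its weight by a power of `x * y`. -/
theorem pgf_neg (n m : ℕ) : pgf x y n (-(m : ℤ)) = (x * y) ^ m * pgf x y n (m : ℤ) := by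
  have hzero : ∀ ℓ < m, (n.choose ((n : ℤ) - -(m : ℤ) - ℓ).toNat : R) = 0 := fun ℓ hℓ => by
    rw [Nat.choose_eq_zero_of_lt (by omega), Nat.cast_zero]
  rcases lt_or_ge n m with h | h
  · rw [pgf_eq_zero_of_lt x y (k := (m : ℤ)) (by exact_mod_cast h), mul_zero]
    unfold pgf
    refine Finset.sum_eq_zero fun ℓ hℓ => ?_
    rw [Finset.mem_range] at hℓ
    rw [hzero ℓ (by omega)]
    simp
  · rw [pgf_natCast x y h]
    unfold pgf
    rw [show n + 1 = m + (n - m + 1) by omega, Finset.sum_range_add,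
      Finset.sum_eq_zero (s := Finset.range m), zero_add, Finset.mul_sum]
    · refine Finset.sum_congr rfl fun ℓ hℓ => ?_
      rw [Finset.mem_range] at hℓ
      rw [if_pos (by omega), show ((n : ℤ) - -(m : ℤ) - (m + ℓ : ℕ)).toNat = n - ℓ by omega,
        Nat.choose_symm (by omega), ← Nat.choose_symm (n := n) (k := m + ℓ) (by omega),
        show n - (m + ℓ) = n - m - ℓ by omega, show n - ℓ = m + (n - m - ℓ) by omega]
      ring
    · intro ℓ hℓ
      rw [Finset.mem_range] at hℓ
      rw [hzero ℓ hℓ]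
      simp

theorem pgf_eq_natAbs (n : ℕ) (k : ℤ) :
    pgf x y n k = (if k < 0 then (x * y) ^ k.natAbs else 1) * pgf x y n (k.natAbs : ℤ) := by
  rcases lt_or_ge k 0 with h | h
  · rw [if_pos h, ← pgf_neg]
    congr 1
    omega
  · rw [if_neg (not_lt.mpr h), one_mul]
    congr 1
    omega

end PathGeneratingFunction

section ReducedMatrix

variable {R : Type*} [CommRing R]

/-- The entries left after clearing `thm10Matrix` by unitriangular column operations,
with `q = x * y`. -/
def reducedEntry (q t : R) (k i j : ℕ) : R :=
  (if j = ((k : ℤ) - i).natAbs then (if k < i then q ^ j else 1) else 0) +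
    t * q ^ i * (if j = k + i then 1 else 0)

/-- The `n × n` matrix of the entries `reducedEntry q t k`. -/
def reducedMatrix (q t : R) (k n : ℕ) : Matrix (Fin n) (Fin n) R :=
  Matrix.of fun i j => reducedEntry q t k i j

theorem sum_fin_ite_mul (n m : ℕ) (c : ℕ → R) (f : ℕ → R) (hf : n ≤ m → f m = 0) :
    ∑ l : Fin n, (if (l : ℕ) = m then c l else 0) * f l = c m * f m := by
  rw [Fin.sum_univ_eq_sum_range (fun l => (if l = m then c l else 0) * f l)]
  simp only [ite_mul, zero_mul, Finset.sum_ite_eq', Finset.mem_range]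
  split_ifs with h
  · rfl
  · rw [hf (not_lt.mp h), mul_zero]

theorem thm10Matrix_eq_mul (x y t : R) (n k : ℕ) :
    thm10Matrix x y t n (k : ℤ) = reducedMatrix (x * y) t k n *
      Matrix.of fun l j : Fin n => pgf x y j.1 ((l : ℕ) : ℤ) := by
  ext i j
  have hvanish : ∀ m, n ≤ m → pgf x y j.1 (m : ℤ) = 0 := fun m hm =>
    pgf_eq_zero_of_lt x y (by have := j.2; omega)
  simp only [thm10Matrix, reducedMatrix, reducedEntry, Matrix.mul_apply, Matrix.of_apply, add_mul,
    Finset.sum_add_distrib]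
  congr 1
  · rw [sum_fin_ite_mul n _ (fun l => if k < (i : ℕ) then (x * y) ^ l else 1)
      (fun l => pgf x y j.1 (l : ℤ)) (hvanish _), pgf_eq_natAbs]
    simp only [sub_neg, Nat.cast_lt]
  · simp only [mul_assoc, ← Finset.mul_sum]
    rw [sum_fin_ite_mul n _ (fun _ => 1) (fun l => pgf x y j.1 (l : ℤ)) (hvanish _)]
    simp

theorem det_thm10Matrix_eq_det_reducedMatrix (x y t : R) (n k : ℕ) :
    (thm10Matrix x y t n (k : ℤ)).det = (reducedMatrix (x * y) t k n).det := by
  have hU : (Matrix.of fun l j : Fin n => pgf x y j.1 ((l : ℕ) : ℤ)).IsUpperTriangular :=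
    fun i j hij => pgf_eq_zero_of_lt x y (Nat.cast_lt.mpr (Fin.lt_def.mp hij))
  rw [thm10Matrix_eq_mul, Matrix.det_mul, Matrix.det_of_isUpperTriangular hU]
  simp [pgf_self]

theorem det_fromBlocks_zero_one_one_zero (β : Type*) [Fintype β] [DecidableEq β] :
    (Matrix.fromBlocks 0 1 1 0 : Matrix (β ⊕ β) (β ⊕ β) R).det = (-1) ^ Fintype.card β := by
  have h := congrArg Matrix.det (Matrix.fromBlocks_multiply (0 : Matrix β β R) (1 : Matrix β β R)
    (1 : Matrix β β R) (0 : Matrix β β R) 1 1 0 1)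
  simpa [Matrix.det_mul, Matrix.det_fromBlocks_zero₂₁, Matrix.det_fromBlocks_one₂₂,
    Matrix.det_neg] using h

theorem det_fromBlocks_fromCols_fromRows {α β : Type*} [Fintype α] [DecidableEq α] [Fintype β]
    [DecidableEq β] (A : Matrix α α R) (B : Matrix α β R) (C : Matrix β α R)
    (X D E : Matrix β β R) :
    (Matrix.fromBlocks A (Matrix.fromCols B 0) (Matrix.fromRows C 0)
      (Matrix.fromBlocks X D E 0)).det = (-1) ^ Fintype.card β * (A.det * D.det * E.det) := by
  have hfac : Matrix.fromBlocks A (Matrix.fromCols B 0) (Matrix.fromRows C 0)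
      (Matrix.fromBlocks X D E 0) =
      Matrix.fromBlocks A (Matrix.fromCols 0 B) (Matrix.fromRows C 0)
        (Matrix.fromBlocks D X 0 E) * Matrix.fromBlocks 1 0 0 (Matrix.fromBlocks 0 1 1 0) := by
    simp [Matrix.fromBlocks_multiply, Matrix.fromCols_mul_fromBlocks]
  have hassoc : (Matrix.fromBlocks A (Matrix.fromCols 0 B) (Matrix.fromRows C 0)
      (Matrix.fromBlocks D X 0 E)).submatrix (Equiv.sumAssoc α β β) (Equiv.sumAssoc α β β) =
      Matrix.fromBlocks (Matrix.fromBlocks A 0 C D) (Matrix.fromRows B X) 0 E := by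
    ext ((i | i) | i) ((j | j) | j) <;> rfl
  rw [hfac, Matrix.det_mul, Matrix.det_fromBlocks_zero₂₁, det_fromBlocks_zero_one_one_zero,
    ← Matrix.det_submatrix_equiv_self (Equiv.sumAssoc α β β), hassoc,
    Matrix.det_fromBlocks_zero₂₁, Matrix.det_fromBlocks_zero₁₂]
  simp only [Matrix.det_one]
  ring

theorem reducedEntry_super (q t : R) {k i j : ℕ} (hk : 0 < k) (h : j = k + i) :
    reducedEntry q t k i j = if i = 0 then 1 + t else t * q ^ i := by
  subst h
  unfold reducedEntry
  rcases Nat.eq_zero_or_pos i with rfl | hi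
  · simp
  · rw [if_neg (c := k + i = _) (by omega), if_neg (c := i = 0) (by omega)]
    simp

theorem reducedEntry_sub (q t : R) {k i j : ℕ} (hk : 0 < k) (h : i = j + k) :
    reducedEntry q t k i j = q ^ j := by
  subst h
  unfold reducedEntry
  rw [if_pos (by omega), if_neg (c := j = _) (by omega)]
  rcases Nat.eq_zero_or_pos j with rfl | hj
  · simp
  · rw [if_pos (by omega)]
    simp

theorem reducedEntry_eq_zero (q t : R) {k i j : ℕ} (h₁ : j ≠ ((k : ℤ) - i).natAbs)
    (h₂ : j ≠ k + i) : reducedEntry q t k i j = 0 := by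
  simp [reducedEntry, h₁, h₂]

/-- Splitting off the last `2 * k` rows and columns. -/
theorem det_reducedMatrix_add (q t : R) {k : ℕ} (hk : 0 < k) (m : ℕ) :
    (reducedMatrix q t k (m + (k + k))).det = (-1) ^ k * ((reducedMatrix q t k m).det *
      (∏ i ∈ Finset.range k, if m + i = 0 then 1 + t else t * q ^ (m + i)) *
      ∏ i ∈ Finset.range k, q ^ (m + i)) := by
  let e : Fin m ⊕ (Fin k ⊕ Fin k) ≃ Fin (m + (k + k)) :=
    (Equiv.sumCongr (Equiv.refl _) finSumFinEquiv).trans finSumFinEquiv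
  have hblock : (reducedMatrix q t k (m + (k + k))).submatrix e e =
      Matrix.fromBlocks (reducedMatrix q t k m)
        (Matrix.fromCols (Matrix.of fun (i : Fin m) (j : Fin k) => reducedEntry q t k i (m + j)) 0)
        (Matrix.fromRows (Matrix.of fun (i : Fin k) (j : Fin m) => reducedEntry q t k (m + i) j) 0)
        (Matrix.fromBlocks (Matrix.of fun i j : Fin k => reducedEntry q t k (m + i) (m + j))
          (Matrix.diagonal fun i : Fin k =>
            if m + (i : ℕ) = 0 then 1 + t else t * q ^ (m + (i : ℕ)))
          (Matrix.diagonal fun i : Fin k => q ^ (m + (i : ℕ))) 0) := by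
    ext (i | i | i) (j | j | j)
    · simp [e, reducedMatrix]
    · simp [e, reducedMatrix]
    · simp only [e, reducedMatrix, Matrix.submatrix_apply, Matrix.of_apply, Equiv.trans_apply,
        Equiv.sumCongr_apply, Sum.map_inl, Sum.map_inr, Equiv.refl_apply, finSumFinEquiv_apply_left,
        finSumFinEquiv_apply_right, Fin.val_castAdd, Fin.val_natAdd, Matrix.fromBlocks_apply₁₂,
        Matrix.fromCols_apply_inr, Matrix.zero_apply]
      exact reducedEntry_eq_zero q t (by omega) (by omega)
    · simp [e, reducedMatrix]
    · simp [e, reducedMatrix]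
    · simp only [e, reducedMatrix, Matrix.submatrix_apply, Matrix.of_apply, Equiv.trans_apply,
        Equiv.sumCongr_apply, Sum.map_inr, finSumFinEquiv_apply_left,
        finSumFinEquiv_apply_right, Fin.val_castAdd, Fin.val_natAdd, Matrix.fromBlocks_apply₂₂,
        Matrix.fromBlocks_apply₁₂, Matrix.diagonal_apply, Fin.ext_iff]
      split_ifs with h h'
      · rw [reducedEntry_super q t hk (by omega), if_pos h']
      · rw [reducedEntry_super q t hk (by omega), if_neg h']
      · exact reducedEntry_eq_zero q t (by omega) (by omega)
    · simp only [e, reducedMatrix, Matrix.submatrix_apply, Matrix.of_apply, Equiv.trans_apply,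
        Equiv.sumCongr_apply, Sum.map_inl, Sum.map_inr, Equiv.refl_apply, finSumFinEquiv_apply_left,
        finSumFinEquiv_apply_right, Fin.val_castAdd, Fin.val_natAdd, Matrix.fromBlocks_apply₂₁,
        Matrix.fromRows_apply_inr, Matrix.zero_apply]
      exact reducedEntry_eq_zero q t (by omega) (by omega)
    · simp only [e, reducedMatrix, Matrix.submatrix_apply, Matrix.of_apply, Equiv.trans_apply,
        Equiv.sumCongr_apply, Sum.map_inr, finSumFinEquiv_apply_left,
        finSumFinEquiv_apply_right, Fin.val_castAdd, Fin.val_natAdd, Matrix.fromBlocks_apply₂₂,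
        Matrix.fromBlocks_apply₂₁, Matrix.diagonal_apply, Fin.ext_iff]
      split_ifs with h
      · rw [reducedEntry_sub q t hk (j := m + j) (by omega), h]
      · exact reducedEntry_eq_zero q t (by omega) (by omega)
    · simp only [e, reducedMatrix, Matrix.submatrix_apply, Matrix.of_apply, Equiv.trans_apply,
        Equiv.sumCongr_apply, Sum.map_inr, finSumFinEquiv_apply_right, Fin.val_natAdd,
        Matrix.fromBlocks_apply₂₂, Matrix.zero_apply]
      exact reducedEntry_eq_zero q t (by omega) (by omega)
  rw [← Matrix.det_submatrix_equiv_self e, hblock, det_fromBlocks_fromCols_fromRows,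
    Matrix.det_diagonal, Matrix.det_diagonal, Fintype.card_fin,
    Fin.prod_univ_eq_prod_range (fun i => if m + i = 0 then 1 + t else t * q ^ (m + i)),
    Fin.prod_univ_eq_prod_range (fun i => q ^ (m + i))]

theorem prod_range_pow_add (q : R) (m k : ℕ) :
    (∏ i ∈ Finset.range k, q ^ (m + i)) * ∏ i ∈ Finset.range k, q ^ (m + i) =
      q ^ (2 * m * k + k * (k - 1)) := by
  rw [Finset.prod_pow_eq_pow_sum, ← pow_add, ← Finset.sum_range_id_mul_two,
    Finset.sum_add_distrib]
  congr 1
  simp only [Finset.sum_const, Finset.card_range, smul_eq_mul]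
  ring

theorem det_reducedMatrix_add_of_pos (q t : R) {k m : ℕ} (hk : 0 < k) (hm : 0 < m) :
    (reducedMatrix q t k (m + (k + k))).det =
      (-1) ^ k * t ^ k * q ^ (2 * m * k + k * (k - 1)) * (reducedMatrix q t k m).det := by
  rw [det_reducedMatrix_add q t hk, ← prod_range_pow_add, Finset.prod_congr rfl
    fun i _ => if_neg (show m + i ≠ 0 by omega), Finset.prod_mul_distrib, Finset.prod_const,
    Finset.card_range]
  ring

theorem det_reducedMatrix_two_mul (q t : R) {k : ℕ} (hk : 0 < k) :
    (reducedMatrix q t k (0 + (k + k))).det =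
      (-1) ^ k * (1 + t) * t ^ (k - 1) * q ^ (k * (k - 1)) := by
  have h := prod_range_pow_add q 0 k
  rw [mul_zero, zero_mul, zero_add] at h
  rw [det_reducedMatrix_add q t hk, ← h, Matrix.det_fin_zero]
  obtain ⟨k, rfl⟩ : ∃ l, k = l + 1 := ⟨k - 1, by omega⟩
  simp only [Finset.prod_range_succ', Nat.add_sub_cancel]
  simp only [zero_add, Nat.add_eq_zero_iff, one_ne_zero, and_false, if_false, if_true,
    Finset.prod_mul_distrib, Finset.prod_const, Finset.card_range]
  ring

theorem det_antidiagonal (n : ℕ) (a : Fin n → R) :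
    (Matrix.of fun i j : Fin n => if (i : ℕ) + j + 1 = n then a i else 0).det =
      (-1) ^ n.choose 2 * ∏ i, a i := by
  induction n with
  | zero => simp
  | succ n ih =>
    rw [Matrix.det_succ_row_zero, Finset.sum_eq_single (Fin.last n)]
    · have hsub : (Matrix.of fun i j : Fin (n + 1) =>
          if (i : ℕ) + j + 1 = n + 1 then a i else 0).submatrix Fin.succ (Fin.last n).succAbove =
          Matrix.of fun i j : Fin n => if (i : ℕ) + j + 1 = n then a i.succ else 0 := by
        ext i j
        simp only [Matrix.submatrix_apply, Matrix.of_apply, Fin.val_succ, Fin.succAbove_last,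
          Fin.val_castSucc]
        congr 1
        simp only [eq_iff_iff]
        omega
      rw [hsub, ih fun i => a i.succ, Fin.prod_univ_succ, Nat.choose_succ_succ' n 1,
        Nat.choose_one_right]
      simp only [Matrix.of_apply, Fin.val_last, Fin.val_zero, zero_add, if_true]
      ring
    · intro j _ hj
      have : (j : ℕ) ≠ n := fun h => hj (Fin.ext h)
      simp [this]
    · simp

theorem det_reducedMatrix_succ (q t : R) {k : ℕ} (hk : 0 < k) :
    (reducedMatrix q t k (k + 1)).det = (-1) ^ (k + k.choose 2) * (1 + t) := by
  have h : reducedMatrix q t k (k + 1) = Matrix.of fun i j : Fin (k + 1) =>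
      if (i : ℕ) + j + 1 = k + 1 then (if i = 0 then 1 + t else 1) else 0 := by
    ext i j
    have hi := i.2
    have hj := j.2
    simp only [reducedMatrix, Matrix.of_apply, Fin.ext_iff, Fin.val_zero]
    split_ifs with h h'
    · rw [reducedEntry_super q t hk (by omega), if_pos h']
    · unfold reducedEntry
      rw [if_pos (by omega), if_neg (by omega), if_neg (by omega), mul_zero, add_zero]
    · exact reducedEntry_eq_zero q t (by omega) (by omega)
  rw [h, det_antidiagonal, Nat.choose_succ_succ' k 1, Nat.choose_one_right, Fin.prod_univ_succ]
  simp [Fin.succ_ne_zero]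

theorem det_reducedMatrix_of_le (q t : R) {k n : ℕ} (hn : 0 < n) (h : n ≤ k) :
    (reducedMatrix q t k n).det = 0 := by
  refine Matrix.det_eq_zero_of_row_eq_zero ⟨0, hn⟩ fun j => ?_
  have hj := j.2
  exact reducedEntry_eq_zero q t (by simp only; omega) (by simp only; omega)

/-- In this range two columns are multiples of the same unit vector. -/
theorem det_reducedMatrix_of_lt_of_lt (q t : R) {k n : ℕ} (h₁ : k + 1 < n) (h₂ : n < 2 * k) :
    (reducedMatrix q t k n).det = 0 := by
  set M := reducedMatrix q t k n with hM
  let a : Fin n := ⟨k - 1, by omega⟩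
  let b : Fin n := ⟨k + 1, by omega⟩
  have hab : b ≠ a := by simp only [a, b, ne_eq, Fin.mk.injEq]; omega
  have hone : ∀ i : Fin n, M i b = t * q * M i a := by
    intro i
    have hi := i.2
    simp only [hM, reducedMatrix, Matrix.of_apply, a, b]
    by_cases hi1 : (i : ℕ) = 1
    · rw [reducedEntry_super q t (by omega) (by omega), if_neg (by omega), hi1]
      simp only [reducedEntry]
      rw [if_pos (by omega), if_neg (by omega), if_neg (by omega)]
      ring
    · rw [reducedEntry_eq_zero q t (by omega) (by omega),
        reducedEntry_eq_zero q t (by omega) (by omega), mul_zero]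
  rw [← Matrix.det_updateCol_add_smul_self M hab (-(t * q))]
  refine Matrix.det_eq_zero_of_column_eq_zero b fun i => ?_
  simp [hone]

theorem det_reducedMatrix_of_mod (q t : R) {k : ℕ} (hk : 0 < k) (n : ℕ)
    (h₀ : n % (2 * k) ≠ 0) (h₁ : n % (2 * k) ≠ (k + 1) % (2 * k)) :
    (reducedMatrix q t k n).det = 0 := by
  induction n using Nat.strong_induction_on with
  | _ n ih =>
    have hn : 0 < n := Nat.pos_of_ne_zero fun h => h₀ (by simp [h])
    rcases le_or_gt n k with h | h
    · exact det_reducedMatrix_of_le q t hn h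
    rcases lt_or_ge n (2 * k) with h' | h'
    · have : n ≠ k + 1 := fun e => h₁ (by rw [e])
      exact det_reducedMatrix_of_lt_of_lt q t (by omega) h'
    · have hne : n ≠ 2 * k := fun e => h₀ (by rw [e, Nat.mod_self])
      obtain ⟨m, rfl⟩ : ∃ m, n = m + 2 * k := ⟨n - 2 * k, by omega⟩
      rw [Nat.add_mod_right] at h₀ h₁
      rw [two_mul, det_reducedMatrix_add_of_pos q t hk (by omega), ih m (by omega) h₀ h₁, mul_zero]

theorem det_reducedMatrix_of_eq_two_mul (q t : R) {k : ℕ} (hk : 0 < k) (r : ℕ) :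
    (reducedMatrix q t k (2 * k * (r + 1))).det =
      (-1) ^ (k * (r + 1)) * (1 + t) * t ^ (k * (r + 1) - 1) *
        q ^ (k * (r + 1) * (2 * k * (r + 1) - k - 1)) := by
  obtain ⟨l, rfl⟩ : ∃ l, k = l + 1 := ⟨k - 1, by omega⟩
  induction r with
  | zero =>
    have h := det_reducedMatrix_two_mul q t hk
    rw [show 2 * (l + 1) * (0 + 1) = 0 + (l + 1 + (l + 1)) by ring, h]
    rw [zero_add, zero_add, mul_one, show l + 1 + (l + 1) - (l + 1) - 1 = l + 1 - 1 by omega]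
  | succ r ih =>
    rw [show 2 * (l + 1) * (r + 1 + 1) = 2 * (l + 1) * (r + 1) + (l + 1 + (l + 1)) by ring,
      det_reducedMatrix_add_of_pos q t hk (by positivity), ih]
    have e₁ : (l + 1) * (r + 1) - 1 = l * r + l + r := by
      rw [Nat.sub_eq_iff_eq_add (by nlinarith)]; ring
    have e₂ : (l + 1) * (r + 1 + 1) - 1 = l * r + 2 * l + r + 1 := by
      rw [Nat.sub_eq_iff_eq_add (by nlinarith)]; ring
    have e₃ : 2 * (l + 1) * (r + 1) - (l + 1) - 1 = 2 * l * r + l + 2 * r := by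
      rw [Nat.sub_sub, Nat.sub_eq_iff_eq_add (by nlinarith)]; ring
    have e₄ : 2 * (l + 1) * (r + 1) + (l + 1 + (l + 1)) - (l + 1) - 1 =
        2 * l * r + 3 * l + 2 * r + 2 := by
      rw [Nat.sub_sub, Nat.sub_eq_iff_eq_add (by nlinarith)]; ring
    rw [e₁, e₂, e₃, e₄, Nat.add_sub_cancel]
    ring

theorem det_reducedMatrix_of_add_eq (q t : R) {k : ℕ} (hk : 0 < k) (r n : ℕ)
    (hn : n = 2 * k * r + k + 1) :
    (reducedMatrix q t k n).det =
      (-1) ^ (k * (r + 1) + k.choose 2) * (1 + t) * t ^ (k * r) * q ^ (k * r * n) := by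
  induction r generalizing n with
  | zero =>
    rw [hn, show 2 * k * 0 + k + 1 = k + 1 by ring, det_reducedMatrix_succ q t hk]
    simp
  | succ r ih =>
    obtain ⟨l, rfl⟩ : ∃ l, k = l + 1 := ⟨k - 1, by omega⟩
    rw [show n = (2 * (l + 1) * r + (l + 1) + 1) + (l + 1 + (l + 1)) by rw [hn]; ring,
      det_reducedMatrix_add_of_pos q t hk (by omega), ih _ rfl, Nat.add_sub_cancel]
    ring

theorem det_reducedMatrix_zero (q t : R) (n : ℕ) :
    (reducedMatrix q t 0 n).det = (1 + t) ^ n * q ^ n.choose 2 := by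
  have h : reducedMatrix q t 0 n = Matrix.diagonal fun i : Fin n => (1 + t) * q ^ (i : ℕ) := by
    ext i j
    simp only [reducedMatrix, Matrix.of_apply, Matrix.diagonal_apply, Fin.ext_iff]
    split_ifs with h
    · rw [← h]
      unfold reducedEntry
      rw [if_pos (c := (i : ℕ) = Int.natAbs _) (by omega),
        if_pos (c := (i : ℕ) = 0 + i) (by omega)]
      rcases Nat.eq_zero_or_pos (i : ℕ) with h0 | h0
      · simp [h0]
      · rw [if_pos h0]
        ring
    · exact reducedEntry_eq_zero q t (by omega) (by omega)
  rw [h, Matrix.det_diagonal, Fin.prod_univ_eq_prod_range (fun i => (1 + t) * q ^ i),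
    Finset.prod_mul_distrib, Finset.prod_const, Finset.card_range, Finset.prod_pow_eq_pow_sum,
    Finset.sum_range_id, Nat.choose_two_right]

end ReducedMatrix

/-- Theorem 10: evaluation of `det_{0≤i,j≤n−1}(P_j(i,k) + t(xy)^i P_j(−i,k))` for
positive `k` (cases `n = 2kn₁−k+1`, stated additively as `n + k = 2kn₁ + 1`; `n = 2kn₁`;
and `n ≢ 0, k+1 (mod 2k)`), together with the value `(1+t)^n (xy)^{C(n,2)}` for `k = 0`. -/
theorem det_thm10Matrix {R : Type*} [CommRing R] (x y t : R) (n : ℕ) (hn : 0 < n) :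
    (∀ k : ℕ, 0 < k →
      (∀ n₁ : ℕ, 0 < n₁ → n + k = 2 * k * n₁ + 1 →
        (thm10Matrix x y t n (k : ℤ)).det =
          (-1 : R) ^ (k * n₁ + Nat.choose k 2) * (1 + t) * t ^ (k * (n₁ - 1)) *
            (x * y) ^ (k * (n₁ - 1) * (2 * k * n₁ - k + 1))) ∧
      (∀ n₁ : ℕ, 0 < n₁ → n = 2 * k * n₁ →
        (thm10Matrix x y t n (k : ℤ)).det =
          (-1 : R) ^ (k * n₁) * (1 + t) * t ^ (k * n₁ - 1) *
            (x * y) ^ (k * n₁ * (2 * k * n₁ - k - 1))) ∧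
      (n % (2 * k) ≠ 0 ∧ n % (2 * k) ≠ (k + 1) % (2 * k) →
        (thm10Matrix x y t n (k : ℤ)).det = 0)) ∧
    (thm10Matrix x y t n (0 : ℤ)).det = (1 + t) ^ n * (x * y) ^ Nat.choose n 2 := by
  refine ⟨fun k hk => ⟨fun n₁ h₁ h => ?_, fun n₁ h₁ h => ?_, fun h => ?_⟩, ?_⟩
  · obtain ⟨r, rfl⟩ : ∃ r, n₁ = r + 1 := ⟨n₁ - 1, by omega⟩
    have e : 2 * k * (r + 1) = 2 * k * r + k + k := by ring
    rw [det_thm10Matrix_eq_det_reducedMatrix,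
      det_reducedMatrix_of_add_eq (x * y) t hk r n (by omega), Nat.add_sub_cancel,
      show 2 * k * (r + 1) - k + 1 = n by omega]
  · obtain ⟨r, rfl⟩ : ∃ r, n₁ = r + 1 := ⟨n₁ - 1, by omega⟩
    rw [det_thm10Matrix_eq_det_reducedMatrix, h, det_reducedMatrix_of_eq_two_mul _ _ hk]
  · rw [det_thm10Matrix_eq_det_reducedMatrix, det_reducedMatrix_of_mod _ _ hk n h.1 h.2]
  · rw [← Nat.cast_zero, det_thm10Matrix_eq_det_reducedMatrix, det_reducedMatrix_zero]
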